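/- For a summary graph H = (N,F) and disjoint subsets M and C of N, the independence model of H after marginalisation over M and conditioning on C equals the independence model induced by the generated graph: α(J_m(H);M,C) = J_m(α_SG(H;M,C)). -/

import Mathlib

/-!
Stable mixed graphs: mixed graphs with arrows, arcs and lines; ribbonless,
summary and ancestral graphs; the generating maps α_RG, α_SG, α_AG;
m-connecting paths, m-separation and induced independence models.
-/

namespace StableMixedGraphs

/-- A mixed graph on node type `V`: a node set together with three edge
relations: arrows (`arrow i j` means an arrow from `i` to `j`), arcs
(two-headed, symmetric) and lines (undirected, symmetric). -/
structure MixedGraph (V : Type) where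
  nodes : Set V
  arrow : V → V → Prop
  arc : V → V → Prop
  line : V → V → Prop

namespace MixedGraph

variable {V W : Type}

/-- Wellformedness: arcs and lines are symmetric relations and all edges join
nodes of the graph. -/
def Wf (G : MixedGraph V) : Prop :=
  (∀ i j, G.arc i j → G.arc j i) ∧
  (∀ i j, G.line i j → G.line j i) ∧
  (∀ i j, G.arrow i j ∨ G.arc i j ∨ G.line i j → i ∈ G.nodes ∧ j ∈ G.nodes)

/-- No loops of any of the three kinds. -/
def Loopless (G : MixedGraph V) : Prop :=
  ∀ i, ¬ G.arrow i i ∧ ¬ G.arc i i ∧ ¬ G.line i i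

/-- A loopless mixed graph with a finite node set. -/
def IsLMG (G : MixedGraph V) : Prop := G.Wf ∧ G.Loopless ∧ G.nodes.Finite

/-- `G.anc i j` : `i` is an ancestor of `j`, i.e. there is a
direction-preserving path from `i` to `j`. -/
def anc (G : MixedGraph V) (i j : V) : Prop := Relation.TransGen G.arrow i j

/-- The set of ancestors of nodes of `C`. -/
def anSet (G : MixedGraph V) (C : Set V) : Set V := {a | ∃ c ∈ C, G.anc a c}

/-- `i` lies on a direction-preserving cycle. -/
def OnDPCycle (G : MixedGraph V) (i : V) : Prop := G.anc i i

/-- `i` is an endpoint of a line. -/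
def LineEndpoint (G : MixedGraph V) (i : V) : Prop := ∃ j, G.line i j

/-- Condition (2) of a ribbon: `i` or a descendant of `i` is an endpoint of a
line or lies on a direction-preserving cycle. -/
def RibbonTail (G : MixedGraph V) (i : V) : Prop :=
  ∃ d, (d = i ∨ G.anc i d) ∧ (G.LineEndpoint d ∨ G.OnDPCycle d)

/-- `G` contains a ribbon: a collider V-configuration `⟨h,i,j⟩` with no
endpoint-identical edge between `h` and `j`, whose inner node `i` (or a
descendant of it) is an endpoint of a line or on a direction-preserving
cycle. -/
def HasRibbon (G : MixedGraph V) : Prop :=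
  ∃ h i j, h ≠ i ∧ i ≠ j ∧ h ≠ j ∧ G.RibbonTail i ∧
    ((G.arc h i ∧ G.arc i j ∧ ¬ G.arc h j) ∨
     (G.arrow h i ∧ G.arrow j i ∧ ¬ G.line h j) ∨
     (G.arrow h i ∧ G.arc i j ∧ ¬ G.arrow h j))

/-- A ribbonless graph: a loopless mixed graph with no ribbon. -/
def IsRG (G : MixedGraph V) : Prop := G.IsLMG ∧ ¬ G.HasRibbon

/-- A directed acyclic graph: only arrows, no direction-preserving cycle. -/
def IsDAG (G : MixedGraph V) : Prop :=
  G.IsLMG ∧ (∀ i j, ¬ G.arc i j) ∧ (∀ i j, ¬ G.line i j) ∧ ∀ i, ¬ G.anc i i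

/-- A summary graph: a loopless mixed graph with no arrowhead pointing to an
endpoint of a line and no direction-preserving cycle. -/
def IsSG (G : MixedGraph V) : Prop :=
  G.IsLMG ∧ (∀ i, G.LineEndpoint i → ∀ k, ¬ G.arrow k i ∧ ¬ G.arc k i) ∧
    ∀ i, ¬ G.anc i i

/-- A simple mixed graph: no loops and no multiple edges. -/
def Simple (G : MixedGraph V) : Prop :=
  G.Loopless ∧ ∀ i j,
    (G.arrow i j → ¬ G.arrow j i ∧ ¬ G.arc i j ∧ ¬ G.line i j) ∧
    (G.arc i j → ¬ G.line i j)

/-- An ancestral graph: a simple mixed graph such that no node is an ancestor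
of one of its parents or spouses, and a node with a neighbour has neither
parents nor spouses. -/
def IsAG (G : MixedGraph V) : Prop :=
  G.Wf ∧ G.Simple ∧ G.nodes.Finite ∧
  (∀ i j, G.arrow j i ∨ G.arc j i → ¬ G.anc i j) ∧
  (∀ i, G.LineEndpoint i → ∀ k, ¬ G.arrow k i ∧ ¬ G.arc k i)

/-- An undirected graph: only lines. -/
def IsUG (G : MixedGraph V) : Prop :=
  G.IsLMG ∧ (∀ i j, ¬ G.arrow i j) ∧ ∀ i j, ¬ G.arc i j

/-- A bidirected graph: only arcs. -/
def IsBG (G : MixedGraph V) : Prop :=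
  G.IsLMG ∧ (∀ i j, ¬ G.arrow i j) ∧ ∀ i j, ¬ G.line i j

/-- Image of a mixed graph under a map of node types. -/
def map (f : V → W) (G : MixedGraph V) : MixedGraph W where
  nodes := f '' G.nodes
  arrow a b := ∃ i j, G.arrow i j ∧ f i = a ∧ f j = b
  arc a b := ∃ i j, G.arc i j ∧ f i = a ∧ f j = b
  line a b := ∃ i j, G.line i j ∧ f i = a ∧ f j = b

end MixedGraph

/-! ### The closure generating new edges (Table 1 of the RG-generating
algorithm), for given marginalisation set `M` and collider set
`S = C ∪ an(C)`.  For every V-configuration whose inner node is a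
non-collider in `M` (rows 1–7) or a collider in `S` (rows 8–10) the
endpoint-identical edge between the endpoints is generated, repeatedly
until closure. -/

mutual
  /-- Generated arrows (`GenArrow H M S j i`: arrow from `j` to `i`). -/
  inductive GenArrow {V : Type} (H : MixedGraph V) (M S : Set V) : V → V → Prop
    | base {i j : V} : H.arrow i j → GenArrow H M S i j
    | row1 {i j m : V} : m ∈ M → j ≠ i →
        GenArrow H M S j m → GenArrow H M S m i → GenArrow H M S j i
    | row2 {i j m : V} : m ∈ M → j ≠ i →
        GenLine H M S j m → GenArrow H M S m i → GenArrow H M S j i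
    | row3 {i j m : V} : m ∈ M → j ≠ i →
        GenLine H M S j m → GenArc H M S m i → GenArrow H M S j i
    | row8 {i j s : V} : s ∈ S → j ≠ i →
        GenArrow H M S j s → GenArc H M S s i → GenArrow H M S j i

  /-- Generated arcs. -/
  inductive GenArc {V : Type} (H : MixedGraph V) (M S : Set V) : V → V → Prop
    | base {i j : V} : H.arc i j → GenArc H M S i j
    | symm {i j : V} : GenArc H M S i j → GenArc H M S j i
    | row4 {i j m : V} : m ∈ M → i ≠ j →
        GenArrow H M S m i → GenArrow H M S m j → GenArc H M S i j
    | row5 {i j m : V} : m ∈ M → i ≠ j →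
        GenArrow H M S m i → GenArc H M S m j → GenArc H M S i j
    | row9 {i j s : V} : s ∈ S → i ≠ j →
        GenArc H M S i s → GenArc H M S s j → GenArc H M S i j

  /-- Generated lines. -/
  inductive GenLine {V : Type} (H : MixedGraph V) (M S : Set V) : V → V → Prop
    | base {i j : V} : H.line i j → GenLine H M S i j
    | symm {i j : V} : GenLine H M S i j → GenLine H M S j i
    | row6 {i j m : V} : m ∈ M → i ≠ j →
        GenLine H M S i m → GenArrow H M S j m → GenLine H M S i j
    | row7 {i j m : V} : m ∈ M → i ≠ j →
        GenLine H M S i m → GenLine H M S m j → GenLine H M S i j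
    | row10 {i j s : V} : s ∈ S → i ≠ j →
        GenArrow H M S i s → GenArrow H M S j s → GenLine H M S i j
end

variable {V : Type}

/-- The RG-generating map `α_RG(H;M,C)`: generate all edges of the closure
and delete the nodes of `M ∪ C`. -/
def alphaRG (H : MixedGraph V) (M C : Set V) : MixedGraph V where
  nodes := H.nodes \ (M ∪ C)
  arrow i j := i ∈ H.nodes \ (M ∪ C) ∧ j ∈ H.nodes \ (M ∪ C) ∧
    GenArrow H M (C ∪ H.anSet C) i j
  arc i j := i ∈ H.nodes \ (M ∪ C) ∧ j ∈ H.nodes \ (M ∪ C) ∧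
    GenArc H M (C ∪ H.anSet C) i j
  line i j := i ∈ H.nodes \ (M ∪ C) ∧ j ∈ H.nodes \ (M ∪ C) ∧
    GenLine H M (C ∪ H.anSet C) i j

/-- The arrowhead-removal operation `α_RG.SG(K;A)`: every arrowhead pointing
at a node of `A` is removed (an arrow at such a node becomes a line, an arc
becomes an arrow, an arc with both endpoints in `A` becomes a line),
repeatedly until closure. -/
def deheadAt (K : MixedGraph V) (A : Set V) : MixedGraph V where
  nodes := K.nodes
  arrow j i := i ∉ A ∧ (K.arrow j i ∨ (K.arc j i ∧ j ∈ A))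
  arc i j := K.arc i j ∧ i ∉ A ∧ j ∉ A
  line i j := K.line i j ∨ (K.arrow j i ∧ i ∈ A) ∨ (K.arrow i j ∧ j ∈ A) ∨
    (K.arc i j ∧ i ∈ A ∧ j ∈ A)

/-- The SG-generating map `α_SG(H;M,C)`: mark the nodes of `an(C)`, apply the
RG-generating construction, then remove all arrowheads pointing at marked
nodes. -/
def alphaSG (H : MixedGraph V) (M C : Set V) : MixedGraph V :=
  deheadAt (alphaRG H M C) (H.anSet C)

/-! ### Step 2 of the AG-generating algorithm: for every V-configuration
`j → k ↔ i` or `j ↔ k ↔ i` with `k ∈ an(i)` (in the current graph) generate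
an arrow from `j` to `i`, respectively an arc between `j` and `i`, until
closure. -/

mutual
  inductive AG2Arrow {V : Type} (K : MixedGraph V) : V → V → Prop
    | base {i j : V} : K.arrow j i → AG2Arrow K j i
    | gen {i j k : V} : j ≠ i → AG2Arrow K j k → AG2Arc K k i →
        AG2Anc K k i → AG2Arrow K j i

  inductive AG2Arc {V : Type} (K : MixedGraph V) : V → V → Prop
    | base {i j : V} : K.arc i j → AG2Arc K i j
    | symm {i j : V} : AG2Arc K i j → AG2Arc K j i
    | gen {i j k : V} : j ≠ i → AG2Arc K j k → AG2Arc K k i →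
        AG2Anc K k i → AG2Arc K j i

  /-- The ancestor relation of the graph being generated in step 2. -/
  inductive AG2Anc {V : Type} (K : MixedGraph V) : V → V → Prop
    | single {i j : V} : AG2Arrow K i j → AG2Anc K i j
    | tail {i k j : V} : AG2Arrow K i k → AG2Anc K k j → AG2Anc K i j
end

/-- The graph after step 2 of the AG-generating algorithm. -/
def ag2 (K : MixedGraph V) : MixedGraph V where
  nodes := K.nodes
  arrow := AG2Arrow K
  arc := AG2Arc K
  line := K.line

/-! ### Step 3 of the AG-generating algorithm: repeatedly replace every arc
between `j` and `i` with `j ∈ an(i)` (in the current graph) by an arrow from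
`j` to `i`. -/

mutual
  inductive AG3Arrow {V : Type} (K : MixedGraph V) : V → V → Prop
    | base {i j : V} : K.arrow j i → AG3Arrow K j i
    | conv {i j : V} : K.arc j i → AG3Anc K j i → AG3Arrow K j i

  /-- The ancestor relation of the graph being generated in step 3. -/
  inductive AG3Anc {V : Type} (K : MixedGraph V) : V → V → Prop
    | single {i j : V} : AG3Arrow K i j → AG3Anc K i j
    | tail {i k j : V} : AG3Arrow K i k → AG3Anc K k j → AG3Anc K i j
end

/-- Steps 2 and 3 of the AG-generating algorithm, applied to a summary
graph: `α_SG.AG`. -/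
def alphaSGAG (K : MixedGraph V) : MixedGraph V :=
  let K2 := ag2 K
  { nodes := K.nodes
    arrow := AG3Arrow K2
    arc := fun i j => K2.arc i j ∧ ¬ AG3Anc K2 i j ∧ ¬ AG3Anc K2 j i
    line := K.line }

/-- The AG-generating map `α_AG(H;M,C)`. -/
def alphaAG (H : MixedGraph V) (M C : Set V) : MixedGraph V :=
  alphaSGAG (alphaSG H M C)

/-! ### Paths, m-connection and m-separation. -/

/-- A step of a walk: it goes from `src` to `tgt` along an edge which has an
arrowhead at `src` iff `hs = true` and an arrowhead at `tgt` iff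
`ht = true` (so `hs = ht = false` is a line, `hs = ht = true` an arc, and
exactly one head an arrow in the corresponding direction). -/
structure Step (V : Type) where
  src : V
  tgt : V
  hs : Bool
  ht : Bool

/-- The edge of a step is present in `G`. -/
def Step.valid (G : MixedGraph V) (s : Step V) : Prop :=
  match s.hs, s.ht with
  | false, false => G.line s.src s.tgt
  | false, true  => G.arrow s.src s.tgt
  | true,  false => G.arrow s.tgt s.src
  | true,  true  => G.arc s.src s.tgt

/-- `w` is a path from `i` to `j` in `G`: a nonempty chained list of valid
steps with no repeated nodes. -/
def IsPath (G : MixedGraph V) (i j : V) (w : List (Step V)) : Prop :=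
  w ≠ [] ∧ (∀ s ∈ w, s.valid G) ∧ List.Chain' (fun a b => a.tgt = b.src) w ∧
    w.head?.map Step.src = some i ∧ w.getLast?.map Step.tgt = some j ∧
    (i :: w.map Step.tgt).Nodup

/-- The path `w` is m-connecting given `M` and `C`: every inner collider node
is in `C ∪ an(C)` and every inner non-collider node is in `M`. -/
def MConnPath (G : MixedGraph V) (M C : Set V) (w : List (Step V)) : Prop :=
  List.Chain'
    (fun a b =>
      (a.ht = true ∧ b.hs = true → a.tgt ∈ C ∪ G.anSet C) ∧
      (¬ (a.ht = true ∧ b.hs = true) → a.tgt ∈ M)) w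

/-- `A ⊥_m B | C` in `G` : there is no m-connecting path between `A` and `B`
given `C` (with `M` the remaining nodes). -/
def MSep (G : MixedGraph V) (A B C : Set V) : Prop :=
  ∀ i ∈ A, ∀ j ∈ B, ∀ w : List (Step V),
    IsPath G i j w → ¬ MConnPath G (G.nodes \ (A ∪ B ∪ C)) C w

/-- The independence model induced by `G` via m-separation: the set of
triples `⟨A,B|C⟩` of pairwise disjoint subsets of the nodes with
`A ⊥_m B | C`. -/
def Jm (G : MixedGraph V) : Set (Set V × Set V × Set V) :=
  {t | t.1 ⊆ G.nodes ∧ t.2.1 ⊆ G.nodes ∧ t.2.2 ⊆ G.nodes ∧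
    Disjoint t.1 t.2.1 ∧ Disjoint t.1 t.2.2 ∧ Disjoint t.2.1 t.2.2 ∧
    MSep G t.1 t.2.1 t.2.2}

/-- The independence model after marginalisation over `M` and conditioning on
`C` : `α(J;M,C)`. -/
def alphaIM (J : Set (Set V × Set V × Set V)) (M C : Set V) :
    Set (Set V × Set V × Set V) :=
  {t | (t.1, t.2.1, t.2.2 ∪ C) ∈ J ∧ (t.1 ∪ t.2.1 ∪ t.2.2) ∩ (M ∪ C) = ∅}

/-! ### Open walks

An edge relation `E a b i j` says that `i` and `j` are joined by an edge with an
arrowhead at `i` iff `a` and an arrowhead at `j` iff `b`. A condition `ok b c v`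
says that a walk may pass through `v`, entering along an edge with head mark `b`
at `v` and leaving along an edge with head mark `c` at `v`. -/

/-- `OpenWalk E ok i a b j`: there is a walk from `i` to `j`, with head mark `a`
at `i` and `b` at `j`, all of whose inner nodes satisfy `ok`. -/
inductive OpenWalk (E : Bool → Bool → V → V → Prop) (ok : Bool → Bool → V → Prop)
    (i : V) (a : Bool) : Bool → V → Prop
  | single {j : V} {b : Bool} : E a b i j → OpenWalk E ok i a b j
  | snoc {m j : V} {b c d : Bool} : OpenWalk E ok i a b m → ok b c m → E c d m j →
      OpenWalk E ok i a d j

/-- An open walk together with the list of the nodes visited after the first one. -/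
inductive TracedWalk (E : Bool → Bool → V → V → Prop) (ok : Bool → Bool → V → Prop)
    (i : V) (a : Bool) : Bool → V → List V → Prop
  | single {j : V} {b : Bool} : E a b i j → TracedWalk E ok i a b j [j]
  | snoc {m j : V} {b c d : Bool} {l : List V} : TracedWalk E ok i a b m l →
      ok b c m → E c d m j → TracedWalk E ok i a d j (l ++ [j])

section Walks

variable {E E' : Bool → Bool → V → V → Prop} {ok ok' : Bool → Bool → V → Prop}

theorem TracedWalk.openWalk {i j : V} {a b : Bool} {l : List V}
    (h : TracedWalk E ok i a b j l) : OpenWalk E ok i a b j := by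
  induction h with
  | single h => exact .single h
  | snoc _ h1 h2 ih => exact .snoc ih h1 h2

theorem TracedWalk.end_mem {i j : V} {a b : Bool} {l : List V}
    (h : TracedWalk E ok i a b j l) : j ∈ l := by
  cases h <;> simp

theorem OpenWalk.mono (hE : ∀ a b i j, E a b i j → E' a b i j)
    (hok : ∀ b c v, ok b c v → ok' b c v) {i j : V} {a b : Bool}
    (h : OpenWalk E ok i a b j) : OpenWalk E' ok' i a b j := by
  induction h with
  | single h => exact .single (hE _ _ _ _ h)
  | snoc _ h1 h2 ih => exact .snoc ih (hok _ _ _ h1) (hE _ _ _ _ h2)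

theorem OpenWalk.append {i m j : V} {a b c d : Bool} (h : OpenWalk E ok i a b m)
    (hm : ok b c m) (h' : OpenWalk E ok m c d j) : OpenWalk E ok i a d j := by
  induction h' with
  | single h1 => exact .snoc h hm h1
  | snoc _ h1 h2 ih => exact .snoc ih h1 h2

theorem OpenWalk.reverse (hE : ∀ a b i j, E a b i j → E b a j i)
    (hok : ∀ b c v, ok b c v → ok c b v) {i j : V} {a b : Bool}
    (h : OpenWalk E ok i a b j) : OpenWalk E ok j b a i := by
  induction h with
  | single h => exact .single (hE _ _ _ _ h)
  | snoc _ h1 h2 ih => exact (OpenWalk.single (hE _ _ _ _ h2)).append (hok _ _ _ h1) ih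

theorem OpenWalk.last_edge {i j : V} {a b : Bool} (h : OpenWalk E ok i a b j) :
    ∃ k e, E e b k j := by
  cases h with
  | single h => exact ⟨_, _, h⟩
  | snoc _ _ h => exact ⟨_, _, h⟩

/-- A traced walk extended by one edge can be cut at any node it visits. -/
theorem TracedWalk.cut {i m : V} {a b : Bool} {l : List V}
    (h : TracedWalk E ok i a b m l) {x : V} (hx : x ∈ l) {c d : Bool} {j : V}
    (hm : ok b c m) (he : E c d m j) :
    ∃ b' c' l', TracedWalk E ok i a b' x l' ∧ l' <+: l ∧ ok b' c' x ∧
      OpenWalk E ok x c' d j := by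
  induction h generalizing c d j with
  | @single q b h =>
    obtain rfl : x = q := by simpa using hx
    exact ⟨_, _, _, .single h, List.prefix_refl _, hm, .single he⟩
  | @snoc n q b e f l h h1 h2 ih =>
    by_cases hxl : x ∈ l
    · obtain ⟨b', c', l', hw, hl, hok, hw'⟩ := ih hxl h1 h2
      exact ⟨b', c', l', hw, hl.trans (List.prefix_append _ _), hok, .snoc hw' hm he⟩
    · obtain rfl : x = q := by simpa [hxl] using hx
      exact ⟨_, _, _, .snoc h h1 h2, List.prefix_refl _, hm, .single he⟩

/-- If loops can be cut out of open walks, then every open walk between distinct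
nodes can be shortened to an open path. A head mark at an endpoint can only change
if that endpoint is also an inner node of the walk. -/
theorem OpenWalk.exists_path
    (hloop : ∀ {i x a b c c' d}, OpenWalk E ok i a b x → ok b c' x →
      OpenWalk E ok x c' d x → ok d c x → ok b c x)
    {i j : V} {a b : Bool} (h : OpenWalk E ok i a b j) (hij : i ≠ j) :
    ∃ a' b' l, TracedWalk E ok i a' b' j l ∧ (i :: l).Nodup ∧
      (a = a' ∨ ∃ b c, ok b c i) ∧ (b = b' ∨ ∃ b c, ok b c j) := by
  suffices H : j = i ∨ ∃ a' b' l, TracedWalk E ok i a' b' j l ∧ (i :: l).Nodup ∧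
      (a = a' ∨ ∃ b c, ok b c i) ∧ (b = b' ∨ ∃ b c, ok b c j) ∧
      ∀ c, ok b c j → ok b' c j by
    obtain rfl | ⟨a', b', l, h1, h2, h3, h4, -⟩ := H
    · exact absurd rfl hij
    · exact ⟨a', b', l, h1, h2, h3, h4⟩
  clear hij
  induction h with
  | @single j b h =>
    by_cases hji : j = i
    · exact .inl hji
    · exact .inr ⟨a, b, [j], .single h, by simpa [eq_comm] using hji, .inl rfl, .inl rfl,
        fun _ h => h⟩
  | @snoc m j b c d hw hm he ih =>
    by_cases hji : j = i
    · exact .inl hji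
    right
    obtain rfl | ⟨a', b', l, hp, hnd, ha, -, hR⟩ := ih
    · exact ⟨c, d, [j], .single he, by simpa [eq_comm] using hji, .inr ⟨_, _, hm⟩, .inl rfl,
        fun _ h => h⟩
    by_cases hjl : j ∈ l
    · obtain ⟨b'', c', l', hp', hl, hok, hw'⟩ := hp.cut hjl (hR _ hm) he
      exact ⟨a', b'', l', hp', hnd.sublist (hl.sublist.cons_cons _), ha, .inr ⟨_, _, hok⟩,
        fun e h => hloop hp'.openWalk hok hw' h⟩
    · refine ⟨a', d, l ++ [j], .snoc hp (hR _ hm) he, ?_, ha, .inl rfl, fun _ h => h⟩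
      rw [← List.cons_append, List.nodup_append]
      refine ⟨hnd, by simp, ?_⟩
      simp only [List.mem_cons, List.not_mem_nil, or_false]
      rintro x (rfl | hx) y rfl
      · exact fun h => hji h.symm
      · rintro rfl
        exact hjl hx

end Walks

/-- Edges of `G` with prescribed head marks. -/
def MixedGraph.edge (G : MixedGraph V) (a b : Bool) (i j : V) : Prop :=
  Step.valid G ⟨i, j, a, b⟩

/-- Colliders have to lie in `T`, non-colliders in `P`. -/
def passable (P T : Set V) (b c : Bool) (v : V) : Prop :=
  (b = true ∧ c = true → v ∈ T) ∧ (¬ (b = true ∧ c = true) → v ∈ P)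

theorem passable.symm {P T : Set V} {b c : Bool} {v : V} (h : passable P T b c v) :
    passable P T c b v := by
  unfold passable at *
  tauto

theorem passable.mono {P P' T T' : Set V} (hP : P ⊆ P') (hT : T ⊆ T') {b c : Bool} {v : V}
    (h : passable P T b c v) : passable P' T' b c v :=
  ⟨fun hc => hT (h.1 hc), fun hc => hP (h.2 hc)⟩

theorem passable.mem {P T : Set V} {b c : Bool} {v : V} (h : passable P T b c v) :
    v ∈ P ∨ v ∈ T := by
  unfold passable at *
  tauto

theorem mConnPath_iff {G : MixedGraph V} {M C : Set V} {w : List (Step V)} :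
    MConnPath G M C w ↔
      w.IsChain fun a b => passable M (C ∪ G.anSet C) a.ht b.hs a.tgt :=
  Iff.rfl

theorem exists_openWalk_of_mConnPath {G : MixedGraph V} {M C : Set V} {i j : V}
    {w : List (Step V)} (hw : IsPath G i j w) (hc : MConnPath G M C w) :
    ∃ a b, OpenWalk G.edge (passable M (C ∪ G.anSet C)) i a b j := by
  obtain ⟨hne, hv, hch, hh, hl, -⟩ := hw
  suffices H : ∀ w : List (Step V), ∀ s, w.getLast? = some s →
      (∀ s ∈ w, s.valid G) → List.IsChain (fun a b => a.tgt = b.src) w →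
      MConnPath G M C w → w.head?.map Step.src = some i →
      ∃ a, OpenWalk G.edge (passable M (C ∪ G.anSet C)) i a s.ht s.tgt by
    rw [Option.map_eq_some_iff] at hl
    obtain ⟨s, hs, rfl⟩ := hl
    obtain ⟨a, ha⟩ := H w s hs hv hch hc hh
    exact ⟨a, _, ha⟩
  clear hne hv hch hh hl hc w
  intro w
  induction w using List.reverseRecOn with
  | nil => simp
  | append_singleton w t ih =>
    intro s hs hv hch hc hh
    obtain rfl : t = s := by simpa using hs
    rcases w.eq_nil_or_concat with rfl | ⟨w', r, rfl⟩
    · simp only [List.nil_append, List.head?_cons, Option.map_some, Option.some.injEq] at hh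
      subst hh
      exact ⟨t.hs, .single (hv t (by simp))⟩
    · rw [mConnPath_iff, List.isChain_append] at hc
      rw [List.isChain_append] at hch
      obtain ⟨a, ha⟩ := ih r (by simp) (fun s hs => hv s (List.mem_append_left _ hs)) hch.1 hc.1
        (by cases w' <;> simpa using hh)
      have h1 := hch.2.2 r (by simp) t (by simp)
      have h2 := hc.2.2 r (by simp) t (by simp)
      refine ⟨a, .snoc ha (c := t.hs) h2 ?_⟩
      rw [h1]
      exact hv t (by simp)

theorem TracedWalk.exists_mConnPath {G : MixedGraph V} {M C : Set V} {i j : V} {a b : Bool}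
    {l : List V} (h : TracedWalk G.edge (passable M (C ∪ G.anSet C)) i a b j l)
    (hnd : (i :: l).Nodup) : ∃ w, IsPath G i j w ∧ MConnPath G M C w := by
  suffices H : ∃ w : List (Step V), w ≠ [] ∧ (∀ s ∈ w, s.valid G) ∧
      List.IsChain (fun a b => a.tgt = b.src) w ∧ w.head?.map Step.src = some i ∧
      (∃ s, w.getLast? = some s ∧ s.tgt = j ∧ s.ht = b) ∧ w.map Step.tgt = l ∧
      MConnPath G M C w by
    obtain ⟨w, h1, h2, h3, h4, ⟨s, h5, rfl, -⟩, rfl, h7⟩ := H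
    exact ⟨w, ⟨h1, h2, h3, h4, by simp [h5], hnd⟩, h7⟩
  clear hnd
  induction h with
  | @single j b h =>
    exact ⟨[⟨i, j, a, b⟩], by simp, List.forall_mem_singleton.2 h, by simp, by simp, by simp,
      by simp, by simp [mConnPath_iff]⟩
  | @snoc m j b c d l hw hm he ih =>
    obtain ⟨w, h1, h2, h3, h4, ⟨s, h5, rfl, rfl⟩, rfl, h7⟩ := ih
    refine ⟨w ++ [⟨s.tgt, j, c, d⟩], by simp, ?_, ?_, ?_, by simp, by simp, ?_⟩
    · intro t ht
      rcases List.mem_append.1 ht with ht | ht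
      · exact h2 t ht
      · obtain rfl := List.mem_singleton.1 ht
        exact he
    · rw [List.isChain_append]
      refine ⟨h3, by simp, ?_⟩
      simp [h5]
    · cases w with
      | nil => exact absurd rfl h1
      | cons t w => simpa using h4
    · rw [mConnPath_iff, List.isChain_append]
      refine ⟨h7, by simp, ?_⟩
      simp only [h5, Option.mem_def, Option.some.injEq, List.head?_cons]
      rintro x rfl y rfl
      exact hm

namespace MixedGraph

theorem edge_symm {G : MixedGraph V} (hG : G.Wf) (a b : Bool) (i j : V) (h : G.edge a b i j) :
    G.edge b a j i := by
  cases a <;> cases b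
  · exact hG.2.1 _ _ h
  · exact h
  · exact h
  · exact hG.1 _ _ h

theorem anSet_of_anc {G : MixedGraph V} {T : Set V} {x s : V} (h : G.anc x s)
    (hs : s ∈ T ∪ G.anSet T) : x ∈ G.anSet T := by
  rcases hs with hs | ⟨t, ht, hst⟩
  · exact ⟨s, hs, h⟩
  · exact ⟨t, ht, h.trans hst⟩

theorem anSet_mono {G : MixedGraph V} {T T' : Set V} (h : T ⊆ T') : G.anSet T ⊆ G.anSet T' :=
  fun _ ⟨c, hc, hx⟩ => ⟨c, h hc, hx⟩

/-- Some arrowhead points to `x`. -/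
def HasHead (G : MixedGraph V) (x : V) : Prop := ∃ k e, G.edge e true k x

theorem HasHead.of_anc {G : MixedGraph V} {x y : V} (h : G.anc x y) : G.HasHead y := by
  cases h with
  | single h => exact ⟨_, false, h⟩
  | tail _ h => exact ⟨_, false, h⟩

theorem IsSG.not_line {G : MixedGraph V} (hG : G.IsSG) {x y : V} (hx : G.HasHead x) :
    ¬ G.edge false false x y := by
  intro h
  obtain ⟨k, e, hk⟩ := hx
  have := hG.2.1 x ⟨y, h⟩ k
  cases e
  · exact this.1 hk
  · exact this.2 hk

/-- In a summary graph, an open walk that leaves a node with an arrowhead through a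
tail is direction-preserving up to its end or up to its first collider. -/
theorem IsSG.descend {G : MixedGraph V} (hG : G.IsSG) {ok : Bool → Bool → V → Prop} {x y : V}
    {a d : Bool} (h : OpenWalk G.edge ok x a d y) (ha : a = false) (hx : G.HasHead x) :
    (d = true ∧ G.anc x y) ∨ ∃ s, G.anc x s ∧ ok true true s := by
  induction h with
  | @single j b h =>
    subst ha
    cases b
    · exact absurd h (hG.not_line hx)
    · exact .inl ⟨rfl, .single h⟩
  | @snoc m j b c d hw hm he ih =>
    obtain ⟨rfl, hanc⟩ | hs := ih
    · cases c
      · cases d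
        · exact absurd he (hG.not_line (.of_anc hanc))
        · exact .inl ⟨rfl, hanc.tail he⟩
      · exact .inr ⟨m, hanc, hm⟩
    · exact .inr hs

theorem IsSG.cut_loop {G : MixedGraph V} (hG : G.IsSG) {P T : Set V} {i x : V}
    {a b c c' d : Bool} (hw : OpenWalk G.edge (passable P (T ∪ G.anSet T)) i a b x)
    (h1 : passable P (T ∪ G.anSet T) b c' x)
    (hl : OpenWalk G.edge (passable P (T ∪ G.anSet T)) x c' d x)
    (h2 : passable P (T ∪ G.anSet T) d c x) : passable P (T ∪ G.anSet T) b c x := by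
  refine ⟨?_, ?_⟩
  · rintro ⟨rfl, rfl⟩
    cases c'
    · obtain ⟨-, h⟩ | ⟨s, hs, hok⟩ := hG.descend hl rfl hw.last_edge
      · exact absurd h (hG.2.2 x)
      · exact .inr (anSet_of_anc hs (hok.1 ⟨rfl, rfl⟩))
    · exact h1.1 ⟨rfl, rfl⟩
  · intro h
    cases b
    · exact h1.2 (by simp)
    · exact h2.2 fun h' => h ⟨rfl, h'.2⟩

end MixedGraph

/-! ### Generated edges and open walks -/

/-- Generated edges with prescribed head marks. -/
def genEdge (H : MixedGraph V) (M S : Set V) (a b : Bool) (i j : V) : Prop :=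
  match a, b with
  | false, false => GenLine H M S i j
  | false, true => GenArrow H M S i j
  | true, false => GenArrow H M S j i
  | true, true => GenArc H M S i j

theorem genEdge.trans {H : MixedGraph V} {M S : Set V} {i m j : V} {a b c d : Bool}
    (h : genEdge H M S a b i m) (hm : passable M S b c m) (h' : genEdge H M S c d m j)
    (hij : i ≠ j) : genEdge H M S a d i j := by
  cases b <;> cases c <;>
    [have hm := hm.2 (by simp); have hm := hm.2 (by simp); have hm := hm.2 (by simp);
      have hm := hm.1 (by simp)] <;>
    cases a <;> cases d <;> simp only [genEdge] at h h' ⊢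
  · exact .row7 hm hij h h'
  · exact .row2 hm hij h h'
  · exact .row2 hm hij.symm h'.symm h
  · exact .row4 hm hij h h'
  · exact .row6 hm hij h h'
  · exact .row3 hm hij h h'
  · exact .row1 hm hij.symm h' h
  · exact .row5 hm hij h h'
  · exact .symm (.row6 hm hij.symm h'.symm h)
  · exact .row1 hm hij h h'
  · exact .row3 hm hij.symm h'.symm h.symm
  · exact .symm (.row5 hm hij.symm h' h.symm)
  · exact .row10 hm hij h h'
  · exact .row8 hm hij h h'
  · exact .row8 hm hij.symm h' h.symm
  · exact .row9 hm hij h h'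

theorem TracedWalk.genEdge {H : MixedGraph V} {M S : Set V} {i j : V} {a b : Bool} {l : List V}
    (h : TracedWalk H.edge (passable M S) i a b j l) (hnd : (i :: l).Nodup) :
    genEdge H M S a b i j := by
  have base : ∀ {i j : V} {a b : Bool}, H.edge a b i j →
      StableMixedGraphs.genEdge H M S a b i j := by
    intro i j a b h
    cases a <;> cases b
    exacts [.base h, .base h, .base h, .base h]
  induction h with
  | single h => exact base h
  | @snoc m j b c d l hw hm he ih =>
    refine (ih (hnd.sublist ((List.sublist_append_left _ _).cons_cons _))).trans hm (base he) ?_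
    rintro rfl
    simp at hnd

mutual

theorem GenArrow.openWalk {H : MixedGraph V} (hH : H.Wf) {M S : Set V} {i j : V}
    (h : GenArrow H M S i j) : OpenWalk H.edge (passable M S) i false true j :=
  match h with
  | .base h => .single h
  | .row1 hm _ h h' => (h.openWalk hH).append ⟨by simp, fun _ => hm⟩ (h'.openWalk hH)
  | .row2 hm _ h h' => (h.openWalk hH).append ⟨by simp, fun _ => hm⟩ (h'.openWalk hH)
  | .row3 hm _ h h' => (h.openWalk hH).append ⟨by simp, fun _ => hm⟩ (h'.openWalk hH)
  | .row8 hm _ h h' => (h.openWalk hH).append ⟨fun _ => hm, by simp⟩ (h'.openWalk hH)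

theorem GenArc.openWalk {H : MixedGraph V} (hH : H.Wf) {M S : Set V} {i j : V}
    (h : GenArc H M S i j) : OpenWalk H.edge (passable M S) i true true j :=
  match h with
  | .base h => .single h
  | .symm h => (h.openWalk hH).reverse (MixedGraph.edge_symm hH) fun _ _ _ h => h.symm
  | .row4 hm _ h h' =>
    ((h.openWalk hH).reverse (MixedGraph.edge_symm hH) fun _ _ _ h => h.symm).append
      ⟨by simp, fun _ => hm⟩ (h'.openWalk hH)
  | .row5 hm _ h h' =>
    ((h.openWalk hH).reverse (MixedGraph.edge_symm hH) fun _ _ _ h => h.symm).append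
      ⟨by simp, fun _ => hm⟩ (h'.openWalk hH)
  | .row9 hm _ h h' => (h.openWalk hH).append ⟨fun _ => hm, by simp⟩ (h'.openWalk hH)

theorem GenLine.openWalk {H : MixedGraph V} (hH : H.Wf) {M S : Set V} {i j : V}
    (h : GenLine H M S i j) : OpenWalk H.edge (passable M S) i false false j :=
  match h with
  | .base h => .single h
  | .symm h => (h.openWalk hH).reverse (MixedGraph.edge_symm hH) fun _ _ _ h => h.symm
  | .row6 hm _ h h' => (h.openWalk hH).append ⟨by simp, fun _ => hm⟩
      ((h'.openWalk hH).reverse (MixedGraph.edge_symm hH) fun _ _ _ h => h.symm)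
  | .row7 hm _ h h' => (h.openWalk hH).append ⟨by simp, fun _ => hm⟩ (h'.openWalk hH)
  | .row10 hm _ h h' => (h.openWalk hH).append ⟨fun _ => hm, by simp⟩
      ((h'.openWalk hH).reverse (MixedGraph.edge_symm hH) fun _ _ _ h => h.symm)

end

theorem genEdge.openWalk {H : MixedGraph V} (hH : H.Wf) {M S : Set V} {i j : V} {a b : Bool}
    (h : genEdge H M S a b i j) : OpenWalk H.edge (passable M S) i a b j := by
  cases a <;> cases b
  · exact GenLine.openWalk hH h
  · exact GenArrow.openWalk hH h
  · exact (GenArrow.openWalk hH h).reverse (MixedGraph.edge_symm hH) fun _ _ _ h => h.symm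
  · exact GenArc.openWalk hH h

/-! ### Edges of the generated summary graph -/

/-- The edges of `α_SG(H;M,C)` are the generated edges between remaining nodes, with
the arrowheads at ancestors of `C` removed. -/
theorem alphaSG_edge_iff {H : MixedGraph V} {M C : Set V} {i j : V} {a b : Bool} :
    (alphaSG H M C).edge a b i j ↔ i ∈ H.nodes \ (M ∪ C) ∧ j ∈ H.nodes \ (M ∪ C) ∧
      ∃ a' b', genEdge H M (C ∪ H.anSet C) a' b' i j ∧
        (a = true ↔ a' = true ∧ i ∉ H.anSet C) ∧ (b = true ↔ b' = true ∧ j ∉ H.anSet C) := by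
  have hs : GenArc H M (C ∪ H.anSet C) j i ↔ GenArc H M (C ∪ H.anSet C) i j :=
    ⟨.symm, .symm⟩
  by_cases hi : i ∈ H.anSet C <;> by_cases hj : j ∈ H.anSet C <;> cases a <;> cases b <;>
    simp only [MixedGraph.edge, Step.valid, alphaSG, deheadAt, alphaRG, genEdge, Bool.exists_bool,
      hi, hj, hs] <;> simp <;> tauto

section Correspondence

variable {H : MixedGraph V} {M C D L : Set V}

theorem OpenWalk.alphaSG_edge (hH : H.IsSG) {i j : V} {a b : Bool}
    (h : OpenWalk H.edge (passable M (C ∪ H.anSet C)) i a b j)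
    (hi : i ∈ H.nodes \ (M ∪ C)) (hj : j ∈ H.nodes \ (M ∪ C)) (hij : i ≠ j) {a' b' : Bool}
    (ha : a' = true ↔ a = true ∧ i ∉ H.anSet C) (hb : b' = true ↔ b = true ∧ j ∉ H.anSet C) :
    (alphaSG H M C).edge a' b' i j := by
  obtain ⟨a₁, b₁, l, hp, hnd, h1, h2⟩ := h.exists_path hH.cut_loop hij
  have key : ∀ v ∈ H.nodes \ (M ∪ C), (∃ b c, passable M (C ∪ H.anSet C) b c v) →
      v ∈ H.anSet C := by
    rintro v ⟨-, hv⟩ ⟨b, c, h⟩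
    have := h.mem
    simp only [Set.mem_union, not_or] at hv this
    tauto
  refine alphaSG_edge_iff.2 ⟨hi, hj, a₁, b₁, hp.genEdge hnd, ?_, ?_⟩
  · rcases h1 with rfl | h1
    · exact ha
    · simp [ha, key i hi h1]
  · rcases h2 with rfl | h2
    · exact hb
    · simp [hb, key j hj h2]

theorem alphaSG_edge_openWalk (hH : H.IsSG) {i j : V} {a b : Bool}
    (h : (alphaSG H M C).edge a b i j) :
    ∃ a' b', OpenWalk H.edge (passable M (C ∪ H.anSet C)) i a' b' j ∧
      (a = true ↔ a' = true ∧ i ∉ H.anSet C) ∧ (b = true ↔ b' = true ∧ j ∉ H.anSet C) := by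
  obtain ⟨-, -, a', b', h, ha, hb⟩ := alphaSG_edge_iff.1 h
  exact ⟨a', b', h.openWalk hH.1.1, ha, hb⟩

theorem anc_of_alphaSG_anc (hH : H.IsSG) {x y : V} (h : (alphaSG H M C).anc x y)
    (hx : H.HasHead x) : H.anc x y ∨ x ∈ H.anSet C := by
  have step : ∀ {u k : V}, (alphaSG H M C).arrow u k → H.HasHead u →
      H.HasHead k ∧ (H.anc u k ∨ u ∈ H.anSet C) := by
    intro u k huk hu
    obtain ⟨a', b', hw, ha, hb⟩ := alphaSG_edge_openWalk (a := false) (b := true) hH huk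
    obtain rfl : b' = true := (hb.1 rfl).1
    refine ⟨hw.last_edge, ?_⟩
    by_cases huC : u ∈ H.anSet C
    · exact .inr huC
    obtain rfl : a' = false := by simpa [huC] using ha
    obtain ⟨-, h⟩ | ⟨s, hs, hok⟩ := hH.descend hw rfl hu
    · exact .inl h
    · exact .inr (MixedGraph.anSet_of_anc hs (hok.1 ⟨rfl, rfl⟩))
  induction h using Relation.TransGen.head_induction_on with
  | single h => exact (step h hx).2
  | head h _ ih =>
    obtain ⟨hk, h | h⟩ := step h hx
    · rcases ih hk with h' | h'
      · exact .inl (h.trans h')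
      · exact .inr (MixedGraph.anSet_of_anc h (.inr h'))
    · exact .inr h

/-- Open walks in `α_SG(H;M,C)` lift to open walks in `H`. -/
theorem OpenWalk.of_alphaSG (hH : H.IsSG) {i j : V} {a b : Bool}
    (h : OpenWalk (alphaSG H M C).edge (passable L (D ∪ (alphaSG H M C).anSet D)) i a b j) :
    ∃ a' b', OpenWalk H.edge (passable (M ∪ L) ((D ∪ C) ∪ H.anSet (D ∪ C))) i a' b' j ∧
      (b = true ↔ b' = true ∧ j ∉ H.anSet C) := by
  have hmono : ∀ b c v, passable M (C ∪ H.anSet C) b c v →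
      passable (M ∪ L) ((D ∪ C) ∪ H.anSet (D ∪ C)) b c v := fun _ _ _ =>
    passable.mono Set.subset_union_left (Set.union_subset_union Set.subset_union_right
      (MixedGraph.anSet_mono Set.subset_union_right))
  induction h with
  | single h =>
    obtain ⟨a', b', hw, -, hb⟩ := alphaSG_edge_openWalk hH h
    exact ⟨a', b', hw.mono (fun _ _ _ _ h => h) hmono, hb⟩
  | @snoc m j b c d hw hm he ih =>
    obtain ⟨a', b', hw', hb⟩ := ih
    obtain ⟨c', d', hv, hc, hd⟩ := alphaSG_edge_openWalk hH he
    refine ⟨a', d', hw'.append ⟨?_, ?_⟩ (hv.mono (fun _ _ _ _ h => h) hmono), hd⟩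
    · rintro ⟨rfl, rfl⟩
      by_cases hmC : m ∈ H.anSet C
      · exact .inr (MixedGraph.anSet_mono Set.subset_union_right hmC)
      rcases hm.1 ⟨hb.2 ⟨rfl, hmC⟩, hc.2 ⟨rfl, hmC⟩⟩ with hmD | ⟨e, heD, hme⟩
      · exact .inl (.inl hmD)
      · rcases anc_of_alphaSG_anc hH hme hw'.last_edge with h | h
        · exact .inr ⟨e, .inl heD, h⟩
        · exact absurd h hmC
    · intro h
      exact .inr (hm.2 fun h' => h ⟨(hb.1 h'.1).1, (hc.1 h'.2).1⟩)

/-- Walks in `H` between remaining nodes that are open given `M` and `C`. -/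
def segment (H : MixedGraph V) (M C : Set V) (a b : Bool) (i j : V) : Prop :=
  i ∈ H.nodes \ (M ∪ C) ∧ j ∈ H.nodes \ (M ∪ C) ∧
    OpenWalk H.edge (passable M (C ∪ H.anSet C)) i a b j

/-- `passable` after removing the arrowheads at ancestors of `C`. -/
def passableDehead (H : MixedGraph V) (C P T : Set V) (b c : Bool) (v : V) : Prop :=
  (b = true ∧ c = true ∧ v ∉ H.anSet C → v ∈ T) ∧
    (¬ (b = true ∧ c = true ∧ v ∉ H.anSet C) → v ∈ P)

theorem segment.arrow (hH : H.IsSG) {u w : V} {b : Bool} (h : segment H M C false b u w)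
    (hu : H.HasHead u) (huC : u ∉ H.anSet C) :
    b = true ∧ w ∉ H.anSet C ∧ (alphaSG H M C).arrow u w := by
  obtain ⟨h1, h2, hw⟩ := h
  obtain ⟨rfl, hanc⟩ | ⟨s, hs, hok⟩ := hH.descend hw rfl hu
  · have hwC : w ∉ H.anSet C := fun h => huC (MixedGraph.anSet_of_anc hanc (.inr h))
    refine ⟨rfl, hwC, ?_⟩
    refine hw.alphaSG_edge (a' := false) (b' := true) hH h1 h2 ?_ (by simp) (by simpa using hwC)
    rintro rfl
    exact hH.2.2 _ hanc
  · exact absurd (MixedGraph.anSet_of_anc hs (hok.1 ⟨rfl, rfl⟩)) huC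

theorem OpenWalk.hasHead_of_segment {ok : Bool → Bool → V → Prop} {x y : V} {a b : Bool}
    (h : OpenWalk (segment H M C) ok x a b y) (hb : b = true) : H.HasHead y := by
  obtain ⟨_, _, -, -, h⟩ := h.last_edge
  subst hb
  exact h.last_edge

theorem segment_descend (hH : H.IsSG) {P T : Set V} {x y : V} {a d : Bool}
    (h : OpenWalk (segment H M C) (passableDehead H C P T) x a d y) (ha : a = false)
    (hx : H.HasHead x) (hxC : x ∉ H.anSet C) :
    (d = true ∧ y ∉ H.anSet C ∧ (alphaSG H M C).anc x y) ∨
      ∃ s ∈ T, (alphaSG H M C).anc x s := by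
  induction h with
  | single h =>
    subst ha
    obtain ⟨h1, h2, h3⟩ := h.arrow hH hx hxC
    exact .inl ⟨h1, h2, .single h3⟩
  | @snoc m j b c d hw hm he ih =>
    obtain ⟨rfl, hmC, hanc⟩ | hs := ih
    · cases c
      · obtain ⟨h1, h2, h3⟩ := he.arrow hH (hw.hasHead_of_segment rfl) hmC
        exact .inl ⟨h1, h2, hanc.tail h3⟩
      · exact .inr ⟨m, hm.1 ⟨rfl, rfl, hmC⟩, hanc⟩
    · exact .inr hs

theorem segment_cut_loop (hH : H.IsSG) {P : Set V} {i x : V} {a b c c' d : Bool}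
    (hw : OpenWalk (segment H M C)
      (passableDehead H C P (D ∪ (alphaSG H M C).anSet D)) i a b x)
    (h1 : passableDehead H C P (D ∪ (alphaSG H M C).anSet D) b c' x)
    (hl : OpenWalk (segment H M C)
      (passableDehead H C P (D ∪ (alphaSG H M C).anSet D)) x c' d x)
    (h2 : passableDehead H C P (D ∪ (alphaSG H M C).anSet D) d c x) :
    passableDehead H C P (D ∪ (alphaSG H M C).anSet D) b c x := by
  refine ⟨?_, ?_⟩
  · rintro ⟨rfl, rfl, hxC⟩
    cases c'
    · obtain ⟨rfl, -, -⟩ | ⟨s, hs, hanc⟩ :=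
        segment_descend hH hl rfl (hw.hasHead_of_segment rfl) hxC
      · exact h2.1 ⟨rfl, rfl, hxC⟩
      · exact .inr (MixedGraph.anSet_of_anc hanc hs)
    · exact h1.1 ⟨rfl, rfl, hxC⟩
  · intro h
    by_cases hxC : x ∈ H.anSet C
    · exact h1.2 (by simp [hxC])
    cases b
    · exact h1.2 (by simp)
    · exact h2.2 fun h' => h ⟨rfl, h'.2⟩

/-- A nodup walk of segments is a path in `α_SG(H;M,C)`. -/
theorem TracedWalk.alphaSG (hH : H.IsSG) {P T : Set V} {i j : V} {a b : Bool} {l : List V}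
    (h : TracedWalk (segment H M C) (passableDehead H C P T) i a b j l)
    (hnd : (i :: l).Nodup) :
    ∃ a' b', TracedWalk (alphaSG H M C).edge (passable P T) i a' b' j l ∧
      (b' = true ↔ b = true ∧ j ∉ H.anSet C) := by
  classical
  have edge : ∀ {u w : V} {a b : Bool}, segment H M C a b u w → u ≠ w →
      ∃ a' b', (StableMixedGraphs.alphaSG H M C).edge a' b' u w ∧
        (a' = true ↔ a = true ∧ u ∉ H.anSet C) ∧ (b' = true ↔ b = true ∧ w ∉ H.anSet C) := by
    rintro u w a b ⟨hu, hw, h⟩ huw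
    exact ⟨decide (a = true ∧ u ∉ H.anSet C), decide (b = true ∧ w ∉ H.anSet C),
      h.alphaSG_edge hH hu hw huw (decide_eq_true_iff) (decide_eq_true_iff),
      decide_eq_true_iff, decide_eq_true_iff⟩
  induction h with
  | @single j b h =>
    obtain ⟨a', b', he, -, hb⟩ := edge h (by rintro rfl; simp at hnd)
    exact ⟨a', b', .single he, hb⟩
  | @snoc m j b c d l hw hm he ih =>
    obtain ⟨a', b', hw', hb⟩ := ih (hnd.sublist ((List.sublist_append_left _ _).cons_cons _))
    obtain ⟨c', d', he', hc, hd⟩ := edge he (by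
      rintro rfl
      rw [← List.cons_append, List.nodup_append] at hnd
      exact hnd.2.2 m (List.mem_cons_of_mem _ hw.end_mem) m (by simp) rfl)
    refine ⟨a', d', .snoc hw' (c := c') ⟨?_, ?_⟩ he', hd⟩
    · rw [hb, hc]
      exact fun h => hm.1 ⟨h.1.1, h.2.1, h.1.2⟩
    · rw [hb, hc]
      exact fun h => hm.2 fun h' => h ⟨⟨h'.1, h'.2.2⟩, h'.2.1, h'.2.2⟩

/-- Ancestors of `D` outside `C ∪ an(C)` reach, through `M`, a remaining node that is
in `D` or an ancestor of `D` in `α_SG(H;M,C)`. -/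
theorem reach_of_mem_anSet (hH : H.IsSG) (hD : D ⊆ H.nodes \ (M ∪ C)) {x : V}
    (hx : x ∈ D ∪ H.anSet D) (hxS : x ∉ C ∪ H.anSet C) :
    (x ∉ M → x ∈ D ∪ (alphaSG H M C).anSet D) ∧
    (x ∈ M → ∃ y ∈ H.nodes \ (M ∪ C), y ∉ H.anSet C ∧ y ∈ D ∪ (alphaSG H M C).anSet D ∧
      H.anc x y ∧ OpenWalk H.edge (passable M (C ∪ H.anSet C)) x false true y) := by
  have hDM : ∀ d ∈ D, d ∉ M := fun d hd h => (hD hd).2 (.inl h)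
  rcases hx with hx | ⟨d, hd, hanc⟩
  · exact ⟨fun _ => .inl hx, fun h => absurd h (hDM x hx)⟩
  have step : ∀ {x k : V}, H.arrow x k → x ∉ C ∪ H.anSet C → (k ∉ C ∪ H.anSet C →
      (k ∉ M → k ∈ D ∪ (alphaSG H M C).anSet D) ∧
      (k ∈ M → ∃ y ∈ H.nodes \ (M ∪ C), y ∉ H.anSet C ∧ y ∈ D ∪ (alphaSG H M C).anSet D ∧
        H.anc k y ∧ OpenWalk H.edge (passable M (C ∪ H.anSet C)) k false true y)) →
      (x ∉ M → x ∈ D ∪ (alphaSG H M C).anSet D) ∧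
      (x ∈ M → ∃ y ∈ H.nodes \ (M ∪ C), y ∉ H.anSet C ∧ y ∈ D ∪ (alphaSG H M C).anSet D ∧
        H.anc x y ∧ OpenWalk H.edge (passable M (C ∪ H.anSet C)) x false true y) := by
    intro x k hxk hxS hk
    have hkS : k ∉ C ∪ H.anSet C := fun h =>
      hxS (.inr (MixedGraph.anSet_of_anc (.single hxk) h))
    have hn := hH.1.1.2.2 x k (.inl hxk)
    have hxk' : OpenWalk H.edge (passable M (C ∪ H.anSet C)) x false true k := .single hxk
    have hreach : ∃ y ∈ H.nodes \ (M ∪ C), y ∉ H.anSet C ∧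
        y ∈ D ∪ (alphaSG H M C).anSet D ∧ H.anc x y ∧
        OpenWalk H.edge (passable M (C ∪ H.anSet C)) x false true y := by
      by_cases hkM : k ∈ M
      · obtain ⟨y, hy, hyC, hyD, hky, hw⟩ := (hk hkS).2 hkM
        exact ⟨y, hy, hyC, hyD, hky.head hxk, hxk'.append ⟨by simp, fun _ => hkM⟩ hw⟩
      · exact ⟨k, ⟨hn.2, fun h => h.elim hkM fun h => hkS (.inl h)⟩, fun h => hkS (.inr h),
          (hk hkS).1 hkM, .single hxk, hxk'⟩
    refine ⟨fun hxM => ?_, fun _ => hreach⟩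
    obtain ⟨y, hy, hyC, hyD, hxy, hw⟩ := hreach
    refine .inr (MixedGraph.anSet_of_anc (.single ?_) hyD)
    refine hw.alphaSG_edge (a' := false) (b' := true) hH
      ⟨hn.1, fun h => h.elim hxM fun h => hxS (.inl h)⟩ hy ?_ (by simp) (by simpa using hyC)
    rintro rfl
    exact hH.2.2 _ hxy
  induction hanc using Relation.TransGen.head_induction_on with
  | single h => exact step h hxS fun _ => ⟨fun _ => .inl hd, fun h => absurd h (hDM d hd)⟩
  | head h _ ih => exact step h hxS ih

/-- Open walks in `H` can be cut into segments, after detours to descendants of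
colliders. -/
theorem OpenWalk.segments (hH : H.IsSG) {P : Set V} (hD : D ⊆ H.nodes \ (M ∪ C))
    (hP : P ⊆ H.nodes \ C) {i j : V} {a b : Bool}
    (h : OpenWalk H.edge (passable P ((D ∪ C) ∪ H.anSet (D ∪ C))) i a b j)
    (hi : i ∈ H.nodes \ (M ∪ C)) (hj : j ∈ H.nodes \ (M ∪ C)) :
    OpenWalk (segment H M C)
      (passableDehead H C (P \ M) (D ∪ (alphaSG H M C).anSet D)) i a b j := by
  set ok := passableDehead H C (P \ M) (D ∪ (alphaSG H M C).anSet D)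
  have close : ∀ {b : Bool} {m : V}, m ∈ H.nodes \ (M ∪ C) →
      (OpenWalk H.edge (passable M (C ∪ H.anSet C)) i a b m ∨
        ∃ u b₁ c₁, u ∈ H.nodes \ (M ∪ C) ∧ OpenWalk (segment H M C) ok i a b₁ u ∧
          ok b₁ c₁ u ∧ OpenWalk H.edge (passable M (C ∪ H.anSet C)) u c₁ b m) →
      OpenWalk (segment H M C) ok i a b m := by
    rintro b m hm (h | ⟨u, b₁, c₁, hu, h1, h2, h3⟩)
    · exact .single ⟨hi, hm, h⟩
    · exact .snoc h1 h2 ⟨hu, hm, h3⟩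
  have extend : ∀ {b c d : Bool} {m n : V},
      (OpenWalk H.edge (passable M (C ∪ H.anSet C)) i a b m ∨
        ∃ u b₁ c₁, u ∈ H.nodes \ (M ∪ C) ∧ OpenWalk (segment H M C) ok i a b₁ u ∧
          ok b₁ c₁ u ∧ OpenWalk H.edge (passable M (C ∪ H.anSet C)) u c₁ b m) →
      passable M (C ∪ H.anSet C) b c m →
      OpenWalk H.edge (passable M (C ∪ H.anSet C)) m c d n →
      (OpenWalk H.edge (passable M (C ∪ H.anSet C)) i a d n ∨
        ∃ u b₁ c₁, u ∈ H.nodes \ (M ∪ C) ∧ OpenWalk (segment H M C) ok i a b₁ u ∧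
          ok b₁ c₁ u ∧ OpenWalk H.edge (passable M (C ∪ H.anSet C)) u c₁ d n) := by
    rintro b c d m n (h | ⟨u, b₁, c₁, hu, h1, h2, h3⟩) hm hw
    · exact .inl (h.append hm hw)
    · exact .inr ⟨u, b₁, c₁, hu, h1, h2, h3.append hm hw⟩
  refine close hj ?_
  clear hj
  induction h with
  | single h => exact .inl (.single h)
  | @snoc m j b c d hw hm he ih =>
    by_cases hbc : b = true ∧ c = true
    · by_cases hmS : m ∈ C ∪ H.anSet C
      · exact extend ih ⟨fun _ => hmS, fun h => absurd hbc h⟩ (.single he)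
      have hmD : m ∈ D ∪ H.anSet D := by
        rcases hm.1 hbc with (h | h) | ⟨e, h | h, hme⟩
        · exact .inl h
        · exact absurd (.inl h) hmS
        · exact .inr ⟨e, h, hme⟩
        · exact absurd (.inr ⟨e, h, hme⟩) hmS
      obtain ⟨h1, h2⟩ := reach_of_mem_anSet hH hD hmD hmS
      by_cases hmM : m ∈ M
      · obtain ⟨y, hy, hyC, hyD, -, hwy⟩ := h2 hmM
        refine .inr ⟨y, true, true, hy,
          close hy (extend ih ⟨fun h => absurd h.2 (by simp), fun _ => hmM⟩ hwy),
          ⟨fun _ => hyD, fun h => absurd ⟨rfl, rfl, hyC⟩ h⟩, ?_⟩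
        exact (hwy.reverse (MixedGraph.edge_symm hH.1.1) fun _ _ _ h => h.symm).snoc
          ⟨by simp, fun _ => hmM⟩ he
      · have hmn : m ∈ H.nodes := by
          cases c
          · simp at hbc
          · cases d
            · exact (hH.1.1.2.2 j m (.inl he)).2
            · exact (hH.1.1.2.2 m j (.inr (.inl he))).1
        have hmV : m ∈ H.nodes \ (M ∪ C) :=
          ⟨hmn, fun h => h.elim hmM fun h => hmS (.inl h)⟩
        refine .inr ⟨m, b, c, hmV, close hmV ih, ⟨fun _ => h1 hmM, fun h => ?_⟩, .single he⟩
        exact absurd ⟨hbc.1, hbc.2, fun h => hmS (.inr h)⟩ h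
    · have hmP := hm.2 hbc
      by_cases hmM : m ∈ M
      · exact extend ih ⟨fun h => absurd h hbc, fun _ => hmM⟩ (.single he)
      · have hmV : m ∈ H.nodes \ (M ∪ C) :=
          ⟨(hP hmP).1, fun h => h.elim hmM (hP hmP).2⟩
        exact .inr ⟨m, b, c, hmV, close hmV ih,
          ⟨fun h => absurd ⟨h.1, h.2.1⟩ hbc, fun _ => ⟨hmP, hmM⟩⟩, .single he⟩

theorem mSep_alphaSG_iff (hH : H.IsSG) (hM : M ⊆ H.nodes) (hMC : Disjoint M C) {A B : Set V}
    (hA : A ⊆ H.nodes \ (M ∪ C)) (hB : B ⊆ H.nodes \ (M ∪ C)) (hD : D ⊆ H.nodes \ (M ∪ C))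
    (hAB : Disjoint A B) : MSep H A B (D ∪ C) ↔ MSep (alphaSG H M C) A B D := by
  have hP : H.nodes \ (A ∪ B ∪ (D ∪ C)) ⊆ H.nodes \ C := fun x hx =>
    ⟨hx.1, fun h => hx.2 (.inr (.inr h))⟩
  have hL : (alphaSG H M C).nodes \ (A ∪ B ∪ D) = (H.nodes \ (A ∪ B ∪ (D ∪ C))) \ M := by
    ext x
    change (x ∈ H.nodes ∧ x ∉ M ∪ C) ∧ x ∉ A ∪ B ∪ D ↔
      (x ∈ H.nodes ∧ x ∉ A ∪ B ∪ (D ∪ C)) ∧ x ∉ M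
    simp only [Set.mem_union]
    tauto
  have hML : M ∪ (H.nodes \ (A ∪ B ∪ (D ∪ C))) \ M = H.nodes \ (A ∪ B ∪ (D ∪ C)) := by
    refine Set.union_sdiff_cancel fun x hx => ⟨hM hx, ?_⟩
    rintro ((h | h) | h | h)
    · exact (hA h).2 (.inl hx)
    · exact (hB h).2 (.inl hx)
    · exact (hD h).2 (.inl hx)
    · exact Set.disjoint_left.1 hMC hx h
  unfold MSep
  rw [hL]
  constructor
  · intro h i hi j hj w hw hc
    have hij : i ≠ j := fun e => Set.disjoint_left.1 hAB hi (e ▸ hj)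
    obtain ⟨a, b, hwalk⟩ := exists_openWalk_of_mConnPath hw hc
    obtain ⟨a', b', hwalk', -⟩ := hwalk.of_alphaSG hH
    rw [hML] at hwalk'
    obtain ⟨_, _, l, ht, hnd, -, -⟩ := hwalk'.exists_path hH.cut_loop hij
    obtain ⟨w', h1, h2⟩ := ht.exists_mConnPath hnd
    exact h i hi j hj w' h1 h2
  · intro h i hi j hj w hw hc
    have hij : i ≠ j := fun e => Set.disjoint_left.1 hAB hi (e ▸ hj)
    obtain ⟨a, b, hwalk⟩ := exists_openWalk_of_mConnPath hw hc
    obtain ⟨_, _, l, ht, hnd, -, -⟩ :=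
      (hwalk.segments hH hD hP (hA hi) (hB hj)).exists_path (segment_cut_loop hH) hij
    obtain ⟨_, _, ht', -⟩ := ht.alphaSG hH hnd
    obtain ⟨w', h1, h2⟩ := ht'.exists_mConnPath hnd
    exact h i hi j hj w' h1 h2

end Correspondence

/-- (Corollary 4) For a summary graph `H` and disjoint
subsets `M` and `C` of its node set,
`α(J_m(H);M,C) = J_m(α_SG(H;M,C))`. -/
theorem stmt_13 {V : Type} (H : MixedGraph V) (M C : Set V)
    (hH : H.IsSG) (hM : M ⊆ H.nodes) (hC : C ⊆ H.nodes) (hMC : Disjoint M C) :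
    alphaIM (Jm H) M C = Jm (alphaSG H M C) := by
  ext ⟨A, B, D⟩
  have hn : (alphaSG H M C).nodes = H.nodes \ (M ∪ C) := rfl
  have hsub : ∀ X : Set V, X ⊆ H.nodes \ (M ∪ C) ↔ X ⊆ H.nodes ∧ X ∩ (M ∪ C) = ∅ := fun X => by
    rw [Set.subset_sdiff, Set.disjoint_iff_inter_eq_empty]
  simp only [alphaIM, Jm, Set.mem_ofPred_eq, hn]
  constructor
  · rintro ⟨⟨hA, hB, hDC, hAB, hAD, hBD, hsep⟩, hdis⟩
    simp only [Set.union_inter_distrib_right, Set.union_empty_iff] at hdis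
    have hA' := (hsub A).2 ⟨hA, hdis.1.1⟩
    have hB' := (hsub B).2 ⟨hB, hdis.1.2⟩
    have hD' := (hsub D).2 ⟨(Set.union_subset_iff.1 hDC).1, hdis.2⟩
    exact ⟨hA', hB', hD', hAB, (Set.disjoint_union_right.1 hAD).1,
      (Set.disjoint_union_right.1 hBD).1, (mSep_alphaSG_iff hH hM hMC hA' hB' hD' hAB).1 hsep⟩
  · rintro ⟨hA, hB, hD, hAB, hAD, hBD, hsep⟩
    have disjC : ∀ X : Set V, X ⊆ H.nodes \ (M ∪ C) → Disjoint X C := fun X hX =>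
      Set.disjoint_left.2 fun x hx hxC => (hX hx).2 (.inr hxC)
    refine ⟨⟨((hsub A).1 hA).1, ((hsub B).1 hB).1, Set.union_subset ((hsub D).1 hD).1 hC, hAB,
      Set.disjoint_union_right.2 ⟨hAD, disjC A hA⟩, Set.disjoint_union_right.2 ⟨hBD, disjC B hB⟩,
      (mSep_alphaSG_iff hH hM hMC hA hB hD hAB).2 hsep⟩, ?_⟩
    simp only [Set.union_inter_distrib_right, Set.union_empty_iff]
    exact ⟨⟨((hsub A).1 hA).2, ((hsub B).1 hB).2⟩, ((hsub D).1 hD).2⟩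

end StableMixedGraphs
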